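/- arXiv:2604.14211 — 3 statements merged into one kernel-verified Lean document; each statement's English description precedes it below -/
import Mathlib

section
/- Let G be a locally finite connected graph. For any distinct vertices x,y ∈ V(G) and any α ∈ [0,1], the α-Ricci curvature satisfies the upper bound Ric_α(x,y) ≤ (1 − α) · 2/d(x,y). -/
namespace ORC

variable {V : Type*}

/-- A coupling of two finitely supported probability distributions `μ` and `ν` on `V`:
a matrix `A : V × V → [0,1]` with finite support whose row sums are `μ` and column sums
are `ν`. -/
def IsCoupling (μ ν : V → ℝ) (A : V → V → ℝ) : Prop :=
  (∀ u v, 0 ≤ A u v ∧ A u v ≤ 1) ∧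
  (Function.support fun p : V × V => A p.1 p.2).Finite ∧
  (∀ u, ∑ᶠ v, A u v = μ u) ∧
  (∀ v, ∑ᶠ u, A u v = ν v)

/-- The 1-Wasserstein distance between finitely supported distributions `μ`, `ν` with
respect to the distance `d`: the infimum over couplings `A` of `Σ A(u,v) d(u,v)`. -/
noncomputable def W1 (d : V → V → ℝ) (μ ν : V → ℝ) : ℝ :=
  sInf {c | ∃ A : V → V → ℝ, IsCoupling μ ν A ∧ c = ∑ᶠ (u : V) (v : V), A u v * d u v}

/-- The graph (shortest-path) distance, as a real number. -/
noncomputable def gdist (G : SimpleGraph V) : V → V → ℝ := fun u v => (G.dist u v : ℝ)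

open scoped Classical in
/-- The Lin–Lu–Yau measure `m_x^α`: mass `α` at `x`, mass `(1-α)/d_x` at each neighbor of
`x`, and `0` elsewhere. -/
noncomputable def mAlpha (G : SimpleGraph V) [∀ v, Fintype (G.neighborSet v)]
    (α : ℝ) (x : V) : V → ℝ := fun v =>
  if v = x then α else if G.Adj x v then (1 - α) / (G.degree x : ℝ) else 0

/-- The `α`-Ricci curvature `Ric_α(x,y) = 1 - W1(m_x^α, m_y^α)/d(x,y)`. -/
noncomputable def ricAlpha (G : SimpleGraph V) [∀ v, Fintype (G.neighborSet v)]
    (α : ℝ) (x y : V) : ℝ :=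
  1 - W1 (gdist G) (mAlpha G α x) (mAlpha G α y) / gdist G x y

end ORC

namespace ORC

/-- A coupling is supported on the square of a finite set, which then carries both marginals. -/
lemma IsCoupling.exists_finset {V : Type*} {μ ν : V → ℝ} {A : V → V → ℝ}
    (h : IsCoupling μ ν A) :
    ∃ T : Finset V, (∀ u v, A u v ≠ 0 → u ∈ T ∧ v ∈ T) ∧
      (∀ u, ∑ v ∈ T, A u v = μ u) ∧ (∀ v, ∑ u ∈ T, A u v = ν v) := by
  classical
  obtain ⟨-, hfin, hμ, hν⟩ := h
  have hT : ∀ u v, A u v ≠ 0 → u ∈ hfin.toFinset.image Prod.fst ∪ hfin.toFinset.image Prod.snd ∧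
      v ∈ hfin.toFinset.image Prod.fst ∪ hfin.toFinset.image Prod.snd := by
    intro u v huv
    have hmem : (u, v) ∈ hfin.toFinset := by simpa using huv
    exact ⟨Finset.mem_union_left _ (Finset.mem_image_of_mem Prod.fst hmem),
      Finset.mem_union_right _ (Finset.mem_image_of_mem Prod.snd hmem)⟩
  refine ⟨_, hT, fun u => ?_, fun v => ?_⟩
  · rw [← hμ u]
    exact (finsum_eq_sum_of_support_subset _ fun v hv => (hT u v hv).2).symm
  · rw [← hν v]
    exact (finsum_eq_sum_of_support_subset _ fun u hu => (hT u v hu).1).symm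

/-- Kantorovich-type lower bound for the cost of a coupling: if `c - f u - g v ≤ d u v`, then the
cost is at least `c - ∫ f dμ - ∫ g dν`. -/
lemma IsCoupling.le_cost {V : Type*} {μ ν : V → ℝ} {A : V → V → ℝ} (h : IsCoupling μ ν A)
    (hμ : ∑ᶠ u, μ u = 1) {d : V → V → ℝ} {f g : V → ℝ} {c : ℝ}
    (hd : ∀ u v, c - f u - g v ≤ d u v) :
    c - ∑ᶠ u, μ u * f u - ∑ᶠ v, ν v * g v ≤ ∑ᶠ (u : V) (v : V), A u v * d u v := by
  obtain ⟨T, hT, hrow, hcol⟩ := h.exists_finset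
  have hμT : ∀ u, μ u ≠ 0 → u ∈ T := by
    intro u hu
    rw [← hrow u] at hu
    obtain ⟨v, -, hv⟩ := Finset.exists_ne_zero_of_sum_ne_zero hu
    exact (hT u v hv).1
  have hνT : ∀ v, ν v ≠ 0 → v ∈ T := by
    intro v hv
    rw [← hcol v] at hv
    obtain ⟨u, -, hu⟩ := Finset.exists_ne_zero_of_sum_ne_zero hv
    exact (hT u v hu).2
  have hcost : ∑ᶠ (u : V) (v : V), A u v * d u v = ∑ u ∈ T, ∑ v ∈ T, A u v * d u v := by
    have hinner : ∀ u, ∑ᶠ v, A u v * d u v = ∑ v ∈ T, A u v * d u v := fun u =>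
      finsum_eq_sum_of_support_subset _ fun v hv => (hT u v (left_ne_zero_of_mul hv)).2
    simp only [hinner]
    refine finsum_eq_sum_of_support_subset _ fun u hu => ?_
    obtain ⟨v, -, hv⟩ := Finset.exists_ne_zero_of_sum_ne_zero hu
    exact (hT u v (left_ne_zero_of_mul hv)).1
  have hf : ∑ᶠ u, μ u * f u = ∑ u ∈ T, ∑ v ∈ T, A u v * f u := by
    rw [finsum_eq_sum_of_support_subset _ fun u hu => hμT u (left_ne_zero_of_mul hu)]
    simp only [← hrow, Finset.sum_mul]
  have hg : ∑ᶠ v, ν v * g v = ∑ u ∈ T, ∑ v ∈ T, A u v * g v := by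
    rw [finsum_eq_sum_of_support_subset _ fun v hv => hνT v (left_ne_zero_of_mul hv),
      Finset.sum_comm]
    simp only [← hcol, Finset.sum_mul]
  have hc : c = ∑ u ∈ T, ∑ v ∈ T, A u v * c := by
    simp only [← Finset.sum_mul, hrow]
    rw [← finsum_eq_sum_of_support_subset _ fun u hu => hμT u hu, hμ, one_mul]
  calc c - ∑ᶠ u, μ u * f u - ∑ᶠ v, ν v * g v
      = ∑ u ∈ T, ∑ v ∈ T, A u v * (c - f u - g v) := by
        rw [hf, hg]
        nth_rewrite 1 [hc]
        simp only [mul_sub, Finset.sum_sub_distrib]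
    _ ≤ ∑ u ∈ T, ∑ v ∈ T, A u v * d u v := by
        gcongr with u _ v _
        · exact (h.1 u v).1
        · exact hd u v
    _ = _ := hcost.symm

/-- The product of two finitely supported probability distributions is a coupling. -/
lemma isCoupling_mul {V : Type*} {μ ν : V → ℝ} (hμ0 : ∀ u, 0 ≤ μ u) (hν0 : ∀ v, 0 ≤ ν v)
    (hμf : (Function.support μ).Finite) (hνf : (Function.support ν).Finite)
    (hμ : ∑ᶠ u, μ u = 1) (hν : ∑ᶠ v, ν v = 1) :
    IsCoupling μ ν fun u v => μ u * ν v := by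
  refine ⟨fun u v => ⟨mul_nonneg (hμ0 u) (hν0 v), ?_⟩, ?_, fun u => ?_, fun v => ?_⟩
  · exact mul_le_one₀ (hμ ▸ single_le_finsum u hμf hμ0) (hν0 v) (hν ▸ single_le_finsum v hνf hν0)
  · exact (hμf.prod hνf).subset fun p hp => ⟨left_ne_zero_of_mul hp, right_ne_zero_of_mul hp⟩
  · beta_reduce
    rw [← mul_finsum, hν, mul_one]
  · beta_reduce
    rw [← finsum_mul, hμ, one_mul]

section mAlpha

variable {V : Type*} (G : SimpleGraph V) [∀ v, Fintype (G.neighborSet v)] (α : ℝ) (x : V)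

lemma mAlpha_nonneg (hα : 0 ≤ α) (hα1 : α ≤ 1) (v : V) : 0 ≤ mAlpha G α x v := by
  have : 0 ≤ 1 - α := sub_nonneg.2 hα1
  unfold mAlpha
  split_ifs <;> positivity

open scoped Classical in
lemma support_mAlpha_subset :
    Function.support (mAlpha G α x) ⊆ ↑(insert x (G.neighborFinset x)) := by
  intro v hv
  by_contra hmem
  simp only [Finset.coe_insert, Set.mem_insert_iff, Finset.mem_coe,
    SimpleGraph.mem_neighborFinset, not_or] at hmem
  exact hv (by simp [mAlpha, hmem.1, hmem.2])

lemma finsum_mAlpha_mul (f : V → ℝ) :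
    ∑ᶠ v, mAlpha G α x v * f v =
      α * f x + (1 - α) / (G.degree x : ℝ) * ∑ v ∈ G.neighborFinset x, f v := by
  classical
  rw [finsum_eq_sum_of_support_subset _ fun v hv =>
    support_mAlpha_subset G α x (left_ne_zero_of_mul hv), Finset.sum_insert (by simp),
    Finset.mul_sum]
  congr 1
  · simp [mAlpha]
  · refine Finset.sum_congr rfl fun v hv => ?_
    rw [SimpleGraph.mem_neighborFinset] at hv
    simp [mAlpha, hv, hv.ne']

variable {G x}

lemma finsum_mAlpha (hx : G.degree x ≠ 0) : ∑ᶠ v, mAlpha G α x v = 1 := by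
  have h := finsum_mAlpha_mul G α x fun _ => 1
  have hx' : (G.degree x : ℝ) ≠ 0 := Nat.cast_ne_zero.2 hx
  simp only [mul_one, Finset.sum_const, SimpleGraph.card_neighborFinset_eq_degree,
    nsmul_eq_mul, div_mul_cancel₀ _ hx'] at h
  rw [h]
  ring

lemma finsum_mAlpha_mul_gdist (hx : G.degree x ≠ 0) :
    ∑ᶠ v, mAlpha G α x v * gdist G x v = 1 - α := by
  have hx' : (G.degree x : ℝ) ≠ 0 := Nat.cast_ne_zero.2 hx
  have hsum : ∑ v ∈ G.neighborFinset x, gdist G x v = G.degree x := by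
    rw [← SimpleGraph.card_neighborFinset_eq_degree, Finset.cast_card]
    refine Finset.sum_congr rfl fun v hv => ?_
    rw [SimpleGraph.mem_neighborFinset] at hv
    simp [gdist, SimpleGraph.dist_eq_one_iff_adj.2 hv]
  rw [finsum_mAlpha_mul, hsum, div_mul_cancel₀ _ hx']
  simp [gdist]

end mAlpha

lemma le_W1_mAlpha {V : Type*} {G : SimpleGraph V} [∀ v, Fintype (G.neighborSet v)]
    (hconn : G.Connected) {x y : V} (hx : G.degree x ≠ 0) (hy : G.degree y ≠ 0)
    {α : ℝ} (hα : 0 ≤ α) (hα1 : α ≤ 1) :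
    gdist G x y - (1 - α) * 2 ≤ W1 (gdist G) (mAlpha G α x) (mAlpha G α y) := by
  classical
  have hfin : ∀ z, (Function.support (mAlpha G α z)).Finite := fun z =>
    (Finset.finite_toSet _).subset (support_mAlpha_subset G α z)
  refine le_csInf ⟨_, _, isCoupling_mul (mAlpha_nonneg G α x hα hα1) (mAlpha_nonneg G α y hα hα1)
    (hfin x) (hfin y) (finsum_mAlpha α hx) (finsum_mAlpha α hy), rfl⟩ ?_
  rintro _ ⟨A, hA, rfl⟩
  have htri : ∀ u v, gdist G x y - gdist G x u - gdist G y v ≤ gdist G u v := by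
    intro u v
    have h₁ := hconn.dist_triangle (u := x) (v := u) (w := y)
    have h₂ := hconn.dist_triangle (u := u) (v := v) (w := y)
    rw [G.dist_comm (u := v)] at h₂
    have h₃ : (G.dist x y : ℝ) ≤ G.dist x u + (G.dist u v + G.dist y v) := by
      exact_mod_cast h₁.trans (Nat.add_le_add_left h₂ _)
    unfold gdist
    linarith
  have h := hA.le_cost (finsum_mAlpha α hx) htri
  rw [finsum_mAlpha_mul_gdist α hx, finsum_mAlpha_mul_gdist α hy] at h
  linarith

end ORC

open ORC

/-- Upper bound on the `α`-Ricci curvature: `Ric_α(x,y) ≤ (1-α)·2/d(x,y)`. -/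
theorem ricAlpha_upper_bound {V : Type*} (G : SimpleGraph V)
    [∀ v, Fintype (G.neighborSet v)] (hconn : G.Connected) (x y : V) (hxy : x ≠ y)
    (α : ℝ) (hα : 0 ≤ α) (hα1 : α ≤ 1) :
    ricAlpha G α x y ≤ (1 - α) * 2 / (G.dist x y : ℝ) := by
  have : Nontrivial V := ⟨x, y, hxy⟩
  have hD : 0 < gdist G x y := Nat.cast_pos.2 (hconn.pos_dist_of_ne hxy)
  have hW := le_W1_mAlpha hconn (hconn.preconnected.degree_pos_of_nontrivial x).ne'
    (hconn.preconnected.degree_pos_of_nontrivial y).ne' hα hα1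
  change 1 - W1 (gdist G) (mAlpha G α x) (mAlpha G α y) / gdist G x y ≤
    (1 - α) * 2 / gdist G x y
  rw [one_sub_div hD.ne']
  gcongr
  linarith
end

section
/- Let G be a locally finite connected graph and let x,y ∈ V(G) be adjacent vertices. Then the Ollivier–Ricci curvature of the edge xy (with respect to the uniform nearest-neighbor measures) satisfies Ric(x,y) ≥ −2·(1 − 1/d_x − 1/d_y)_+, which equals −2 + 2/d_x + 2/d_y when d_x > 1 and d_y > 1, and equals 0 otherwise. Here (A)_+ := max(A, 0). -/
namespace ORC

variable {V : Type*}

open scoped Classical in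
/-- The uniform nearest-neighbor measure `m_x`: mass `1/d_x` at each neighbor of `x` and
`0` elsewhere. -/
noncomputable def mUnif (G : SimpleGraph V) [∀ v, Fintype (G.neighborSet v)]
    (x : V) : V → ℝ := fun v =>
  if G.Adj x v then 1 / (G.degree x : ℝ) else 0

/-- The Ollivier–Ricci curvature of an edge `xy` (so `d(x,y) = 1`) with respect to the
uniform nearest-neighbor measures: `Ric(x,y) = 1 - W1(m_x, m_y)`. -/
noncomputable def ricEdge (G : SimpleGraph V) [∀ v, Fintype (G.neighborSet v)]
    (x y : V) : ℝ :=
  1 - W1 (gdist G) (mUnif G x) (mUnif G y)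

end ORC

open ORC

namespace ORC

variable {V : Type*}

open scoped Classical in
/-- A nonnegative matrix on `S ×ˢ T` whose row and column sums are `μ` and `ν` bounds the
Wasserstein distance by its transport cost. -/
theorem W1_le_sum {d : V → V → ℝ} (hd : ∀ u v, 0 ≤ d u v) {μ ν : V → ℝ} {S T : Finset V}
    (f : V → V → ℝ) (hf : ∀ u ∈ S, ∀ v ∈ T, 0 ≤ f u v) (hμ : ∀ u, μ u ≤ 1)
    (hμS : ∀ u ∉ S, μ u = 0) (hνT : ∀ v ∉ T, ν v = 0)
    (hrow : ∀ u ∈ S, ∑ v ∈ T, f u v = μ u) (hcol : ∀ v ∈ T, ∑ u ∈ S, f u v = ν v) :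
    W1 d μ ν ≤ ∑ u ∈ S, ∑ v ∈ T, f u v * d u v := by
  refine csInf_le ⟨0, ?_⟩ ⟨fun u v => if u ∈ S ∧ v ∈ T then f u v else 0, ⟨?_, ?_, ?_, ?_⟩, ?_⟩
  · rintro c ⟨A, hA, rfl⟩
    exact finsum_nonneg fun u => finsum_nonneg fun v => mul_nonneg (hA.1 u v).1 (hd u v)
  · intro u v
    dsimp only
    split_ifs with h
    · refine ⟨hf u h.1 v h.2, le_trans ?_ (hμ u)⟩
      rw [← hrow u h.1]
      exact Finset.single_le_sum (hf u h.1) h.2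
    · exact ⟨le_rfl, zero_le_one⟩
  · refine (S ×ˢ T).finite_toSet.subset fun p hp => ?_
    by_contra h
    refine hp (if_neg fun h' => h ?_)
    simpa using h'
  · intro u
    by_cases hu : u ∈ S
    · rw [← hrow u hu, finsum_eq_sum_of_support_subset (s := T)]
      · exact Finset.sum_congr rfl fun v hv => if_pos ⟨hu, hv⟩
      · intro v hv
        by_contra h
        exact hv (if_neg fun h' => h h'.2)
    · simp [hu, hμS u hu]
  · intro v
    by_cases hv : v ∈ T
    · rw [← hcol v hv, finsum_eq_sum_of_support_subset (s := S)]
      · exact Finset.sum_congr rfl fun u hu => if_pos ⟨hu, hv⟩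
      · intro u hu
        by_contra h
        exact hu (if_neg fun h' => h h'.1)
    · simp [hv, hνT v hv]
  · rw [finsum_eq_sum_of_support_subset (s := S)]
    · refine Finset.sum_congr rfl fun u hu => ?_
      rw [finsum_eq_sum_of_support_subset (s := T)]
      · exact Finset.sum_congr rfl fun v hv => by simp [hu, hv]
      · intro v hv
        by_contra h
        have h' : v ∉ T := h
        simp [h'] at hv
    · intro u hu
      by_contra h
      have h' : u ∉ S := h
      simp [h'] at hu

variable (G : SimpleGraph V) [∀ v, Fintype (G.neighborSet v)]

theorem degree_pos_of_adj {x y : V} (h : G.Adj x y) : 1 ≤ G.degree x :=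
  (G.degree_pos_iff_exists_adj x).2 ⟨y, h⟩

open scoped Classical in
/-- A coupling of `m_x` and `m_y` costs at most `1` plus twice the mass it moves from
neighbors of `x` other than `y` to neighbors of `y` other than `x`. -/
theorem W1_mUnif_le {x y : V} (hadj : G.Adj x y) (f : V → V → ℝ)
    (hf : ∀ u v, 0 ≤ f u v)
    (hrow : ∀ u ∈ G.neighborFinset x, ∑ v ∈ G.neighborFinset y, f u v = 1 / (G.degree x : ℝ))
    (hcol : ∀ v ∈ G.neighborFinset y, ∑ u ∈ G.neighborFinset x, f u v = 1 / (G.degree y : ℝ)) :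
    W1 (gdist G) (mUnif G x) (mUnif G y) ≤ 1 + 2 *
      ∑ u ∈ (G.neighborFinset x).erase y, ∑ v ∈ (G.neighborFinset y).erase x, f u v := by
  have ha : (1 : ℝ) ≤ G.degree x := by exact_mod_cast degree_pos_of_adj G hadj
  have hle : W1 (gdist G) (mUnif G x) (mUnif G y) ≤
      ∑ u ∈ G.neighborFinset x, ∑ v ∈ G.neighborFinset y, f u v * gdist G u v := by
    refine W1_le_sum (fun u v => Nat.cast_nonneg _) f (fun u _ v _ => hf u v) (fun u => ?_)
      (fun u hu => ?_) (fun v hv => ?_) (fun u hu => ?_) (fun v hv => ?_)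
    · unfold mUnif
      split_ifs
      · exact (div_le_one (by linarith)).2 ha
      · exact zero_le_one
    · exact if_neg (by simpa using hu)
    · exact if_neg (by simpa using hv)
    · rw [hrow u hu]; exact (if_pos (by simpa using hu)).symm
    · rw [hcol v hv]; exact (if_pos (by simpa using hv)).symm
  have hdist : ∀ u ∈ G.neighborFinset x, ∀ v ∈ G.neighborFinset y,
      gdist G u v ≤ 1 + 2 * if u ≠ y ∧ v ≠ x then 1 else 0 := by
    intro u hu v hv
    rw [SimpleGraph.mem_neighborFinset] at hu hv
    unfold gdist
    split_ifs with h
    · have := SimpleGraph.dist_le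
        (SimpleGraph.Walk.cons hu.symm (.cons hadj (.cons hv .nil)))
      norm_num at this ⊢
      exact_mod_cast this
    · have : G.dist u v = 1 := by
        rw [SimpleGraph.dist_eq_one_iff_adj]
        by_cases h1 : u = y
        · exact h1 ▸ hv
        · have h2 : v = x := by tauto
          exact h2 ▸ hu.symm
      simp [this]
  have hmass : ∑ u ∈ G.neighborFinset x, ∑ v ∈ G.neighborFinset y, f u v = 1 := by
    rw [Finset.sum_congr rfl hrow, Finset.sum_const, SimpleGraph.card_neighborFinset_eq_degree,
      nsmul_eq_mul]
    field_simp
  refine hle.trans ?_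
  calc ∑ u ∈ G.neighborFinset x, ∑ v ∈ G.neighborFinset y, f u v * gdist G u v
      ≤ ∑ u ∈ G.neighborFinset x, ∑ v ∈ G.neighborFinset y,
          (f u v + 2 * if u ≠ y ∧ v ≠ x then f u v else 0) := by
        refine Finset.sum_le_sum fun u hu => Finset.sum_le_sum fun v hv => ?_
        refine (mul_le_mul_of_nonneg_left (hdist u hu v hv) (hf u v)).trans_eq ?_
        split_ifs <;> ring
    _ = _ := by
        simp only [Finset.sum_add_distrib, hmass, ← Finset.mul_sum, ite_and,
          ← Finset.filter_ne', Finset.sum_filter]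
        congr 2
        refine Finset.sum_congr rfl fun u _ => ?_
        split_ifs <;> simp

open scoped Classical in
theorem W1_mUnif_le_one {x y : V} (hadj : G.Adj x y)
    (h : G.degree x = 1 ∨ G.degree y = 1) :
    W1 (gdist G) (mUnif G x) (mUnif G y) ≤ 1 := by
  have ha : (0 : ℝ) < G.degree x := by exact_mod_cast degree_pos_of_adj G hadj
  have hb : (0 : ℝ) < G.degree y := by exact_mod_cast degree_pos_of_adj G hadj.symm
  refine (W1_mUnif_le G hadj (fun _ _ => 1 / (G.degree x * G.degree y : ℝ))
    (fun _ _ => by positivity) (fun u _ => ?_) (fun v _ => ?_)).trans_eq ?_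
  · rw [Finset.sum_const, SimpleGraph.card_neighborFinset_eq_degree, nsmul_eq_mul]
    field_simp
  · rw [Finset.sum_const, SimpleGraph.card_neighborFinset_eq_degree, nsmul_eq_mul]
    field_simp
  · have hx : ((G.neighborFinset x).erase y).card = G.degree x - 1 := by
      rw [Finset.card_erase_of_mem (by simpa using hadj),
        SimpleGraph.card_neighborFinset_eq_degree]
    have hy : ((G.neighborFinset y).erase x).card = G.degree y - 1 := by
      rw [Finset.card_erase_of_mem (by simpa using hadj.symm),
        SimpleGraph.card_neighborFinset_eq_degree]
    simp only [Finset.sum_const, hx, hy]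
    rcases h with h | h <;> simp [h]

theorem one_sub_one_div_sub_one_div_nonneg {a b : ℝ} (ha : 2 ≤ a) (hb : 2 ≤ b) :
    0 ≤ 1 - 1 / a - 1 / b := by
  have h1 : 1 / a ≤ 1 / 2 := one_div_le_one_div_of_le (by norm_num) ha
  have h2 : 1 / b ≤ 1 / 2 := one_div_le_one_div_of_le (by norm_num) hb
  linarith

open scoped Classical in
theorem W1_mUnif_le_of_two_le {x y : V} (hadj : G.Adj x y)
    (hx : 2 ≤ G.degree x) (hy : 2 ≤ G.degree y) :
    W1 (gdist G) (mUnif G x) (mUnif G y) ≤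
      1 + 2 * (1 - 1 / (G.degree x : ℝ) - 1 / (G.degree y : ℝ)) := by
  have hyx : y ∈ G.neighborFinset x := by simpa using hadj
  have hxy : x ∈ G.neighborFinset y := by simpa using hadj.symm
  have hcx : (((G.neighborFinset x).erase y).card : ℝ) = G.degree x - 1 := by
    rw [Finset.card_erase_of_mem hyx, SimpleGraph.card_neighborFinset_eq_degree,
      Nat.cast_sub (by omega), Nat.cast_one]
  have hcy : (((G.neighborFinset y).erase x).card : ℝ) = G.degree y - 1 := by
    rw [Finset.card_erase_of_mem hxy, SimpleGraph.card_neighborFinset_eq_degree,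
      Nat.cast_sub (by omega), Nat.cast_one]
  have hle := W1_mUnif_le G hadj
  have ha : (2 : ℝ) ≤ G.degree x := by exact_mod_cast hx
  have hb : (2 : ℝ) ≤ G.degree y := by exact_mod_cast hy
  generalize (G.degree x : ℝ) = a at *
  generalize (G.degree y : ℝ) = b at *
  have hs := one_sub_one_div_sub_one_div_nonneg ha hb
  have ha1 : 0 < a - 1 := by linarith
  have hb1 : 0 < b - 1 := by linarith
  have ha0 : 0 < a := by linarith
  have hb0 : 0 < b := by linarith
  let f : V → V → ℝ := fun u v =>
    if u = y then (if v = x then 0 else 1 / (a * (b - 1)))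
    else if v = x then 1 / (b * (a - 1)) else (1 - 1 / a - 1 / b) / ((a - 1) * (b - 1))
  have hf : ∀ u v, 0 ≤ f u v := by
    intro u v
    dsimp only [f]
    split_ifs <;> positivity
  have hT : ∀ u, ∑ v ∈ (G.neighborFinset y).erase x, f u v =
      if u = y then 1 / a else (1 - 1 / a - 1 / b) / (a - 1) := by
    intro u
    rw [Finset.sum_congr rfl (g := fun _ => if u = y then 1 / (a * (b - 1)) else
      (1 - 1 / a - 1 / b) / ((a - 1) * (b - 1))) fun v hv => by
        simp [f, Finset.ne_of_mem_erase hv], Finset.sum_const, nsmul_eq_mul, hcy]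
    split_ifs <;> field_simp
  have hS : ∀ v, ∑ u ∈ (G.neighborFinset x).erase y, f u v =
      if v = x then 1 / b else (1 - 1 / a - 1 / b) / (b - 1) := by
    intro v
    rw [Finset.sum_congr rfl (g := fun _ => if v = x then 1 / (b * (a - 1)) else
      (1 - 1 / a - 1 / b) / ((a - 1) * (b - 1))) fun u hu => by
        simp [f, Finset.ne_of_mem_erase hu], Finset.sum_const, nsmul_eq_mul, hcx]
    split_ifs <;> field_simp
  refine (hle f hf (fun u _ => ?_) (fun v _ => ?_)).trans_eq ?_
  · rw [← Finset.add_sum_erase _ _ hxy, hT]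
    by_cases h : u = y
    · simp [f, h]
    · simp only [f, h, if_true, if_false]
      field_simp
      ring
  · rw [← Finset.add_sum_erase _ _ hyx, hS]
    by_cases h : v = x
    · simp [f, h]
    · simp only [f, h, if_true, if_false]
      field_simp
      ring
  · rw [Finset.sum_congr rfl (g := fun _ => (1 - 1 / a - 1 / b) / (a - 1)) fun u hu => by
      rw [hT, if_neg (Finset.ne_of_mem_erase hu)], Finset.sum_const, nsmul_eq_mul, hcx,
      mul_div_cancel₀ _ ha1.ne']

end ORC

/-- Jost–Liu lower bound: for adjacent vertices `x, y`,
`Ric(x,y) ≥ -2(1 - 1/d_x - 1/d_y)₊`, which equals `-2 + 2/d_x + 2/d_y` when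
`d_x > 1` and `d_y > 1`, and equals `0` otherwise. -/
theorem jost_liu_lower_bound {V : Type*} (G : SimpleGraph V)
    [∀ v, Fintype (G.neighborSet v)] (hconn : G.Connected) (x y : V) (hadj : G.Adj x y) :
    (-2 * max (1 - 1 / (G.degree x : ℝ) - 1 / (G.degree y : ℝ)) 0 ≤ ricEdge G x y) ∧
    (1 < G.degree x ∧ 1 < G.degree y →
      -2 * max (1 - 1 / (G.degree x : ℝ) - 1 / (G.degree y : ℝ)) 0
        = -2 + 2 / (G.degree x : ℝ) + 2 / (G.degree y : ℝ)) ∧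
    (¬(1 < G.degree x ∧ 1 < G.degree y) →
      -2 * max (1 - 1 / (G.degree x : ℝ) - 1 / (G.degree y : ℝ)) 0 = 0) := by
  have hx := degree_pos_of_adj G hadj
  have hy := degree_pos_of_adj G hadj.symm
  have hpos : 1 < G.degree x ∧ 1 < G.degree y →
      0 ≤ 1 - 1 / (G.degree x : ℝ) - 1 / (G.degree y : ℝ) := fun h =>
    one_sub_one_div_sub_one_div_nonneg (by exact_mod_cast h.1) (by exact_mod_cast h.2)
  have hleaf : ¬(1 < G.degree x ∧ 1 < G.degree y) → G.degree x = 1 ∨ G.degree y = 1 := by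
    omega
  have hneg : ¬(1 < G.degree x ∧ 1 < G.degree y) →
      1 - 1 / (G.degree x : ℝ) - 1 / (G.degree y : ℝ) ≤ 0 := by
    intro h
    rcases hleaf h with h | h <;> simp [h]
  refine ⟨?_, fun h => ?_, fun h => ?_⟩
  · unfold ricEdge
    by_cases h : 1 < G.degree x ∧ 1 < G.degree y
    · rw [max_eq_left (hpos h)]
      linarith [W1_mUnif_le_of_two_le G hadj h.1 h.2]
    · rw [max_eq_right (hneg h)]
      linarith [W1_mUnif_le_one G hadj (hleaf h)]
  · rw [max_eq_left (hpos h)]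
    ring
  · rw [max_eq_right (hneg h), mul_zero]
end

section
/- Let T be a (locally finite, connected) tree and let x,y ∈ V(T) be adjacent vertices. Then W1(m_x, m_y) = 1 + 2·(1 − 1/d_x − 1/d_y)_+, so the Ollivier–Ricci curvature of the edge xy equals the lower bound −2·(1 − 1/d_x − 1/d_y)_+, i.e. trees attain equality in the Jost–Liu lower bound. -/
open ORC

namespace ORC

variable {V : Type*}

section Coupling

variable {μ ν : V → ℝ} {A : V → V → ℝ}

lemma IsCoupling.swap (h : IsCoupling μ ν A) : IsCoupling ν μ (fun u v => A v u) :=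
  ⟨fun u v => h.1 v u, h.2.1.preimage (Prod.swap_injective.injOn), h.2.2.2, h.2.2.1⟩

lemma IsCoupling.le_left (h : IsCoupling μ ν A) (u v : V) : A u v ≤ μ u := by
  rw [← h.2.2.1 u]
  have hfin : (Function.support fun v => A u v).Finite :=
    h.2.1.preimage ((Prod.mk_right_injective u).injOn)
  exact single_le_finsum v hfin fun w => (h.1 u w).1

lemma IsCoupling.le_right (h : IsCoupling μ ν A) (u v : V) : A u v ≤ ν v :=
  h.swap.le_left v u

lemma IsCoupling.mem_of_ne_zero (h : IsCoupling μ ν A) {p q : Finset V}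
    (hp : ∀ u ∉ p, μ u = 0) (hq : ∀ v ∉ q, ν v = 0) {u v : V} (huv : A u v ≠ 0) :
    u ∈ p ∧ v ∈ q := by
  have h0 := (h.1 u v).1
  constructor <;> by_contra hmem
  · exact huv (le_antisymm (hp u hmem ▸ h.le_left u v) h0)
  · exact huv (le_antisymm (hq v hmem ▸ h.le_right u v) h0)

lemma finsum_eq_sum_of_forall_mem {f : V → ℝ} {s : Finset V} (h : ∀ u, f u ≠ 0 → u ∈ s) :
    ∑ᶠ u, f u = ∑ u ∈ s, f u :=
  finsum_eq_sum_of_support_subset f fun u hu => h u hu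

lemma finsum_finsum_eq_sum_sum {f : V → V → ℝ} {p q : Finset V}
    (hf : ∀ u v, f u v ≠ 0 → u ∈ p ∧ v ∈ q) :
    ∑ᶠ (u : V) (v : V), f u v = ∑ u ∈ p, ∑ v ∈ q, f u v := by
  have hinner (u : V) : ∑ᶠ v, f u v = ∑ v ∈ q, f u v :=
    finsum_eq_sum_of_forall_mem fun v hv => (hf u v hv).2
  simp_rw [hinner]
  refine finsum_eq_sum_of_forall_mem fun u hu => ?_
  obtain ⟨v, -, hv⟩ := Finset.exists_ne_zero_of_sum_ne_zero hu
  exact (hf u v hv).1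

lemma isCoupling_of_sum_eq {p q : Finset V} (h0 : ∀ u v, 0 ≤ A u v)
    (hsupp : ∀ u v, A u v ≠ 0 → u ∈ p ∧ v ∈ q) (hμ : ∀ u, μ u ≤ 1)
    (hrow : ∀ u, ∑ v ∈ q, A u v = μ u) (hcol : ∀ v, ∑ u ∈ p, A u v = ν v) :
    IsCoupling μ ν A := by
  refine ⟨fun u v => ⟨h0 u v, ?_⟩, ?_, fun u => ?_, fun v => ?_⟩
  · by_cases huv : A u v = 0
    · simp [huv]
    · calc A u v ≤ ∑ v ∈ q, A u v :=
            Finset.single_le_sum (fun w _ => h0 u w) (hsupp u v huv).2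
        _ ≤ 1 := hrow u ▸ hμ u
  · refine (p ×ˢ q).finite_toSet.subset fun z hz => ?_
    simpa using hsupp z.1 z.2 hz
  · rw [← hrow u]
    exact finsum_eq_sum_of_forall_mem fun v hv => (hsupp u v hv).2
  · rw [← hcol v]
    exact finsum_eq_sum_of_forall_mem fun u hu => (hsupp u v hu).1

end Coupling

section Uniform

variable (G : SimpleGraph V) [∀ v, Fintype (G.neighborSet v)] {x y : V}

lemma mUnif_nonneg (x v : V) : 0 ≤ mUnif G x v := by
  unfold mUnif
  split_ifs <;> positivity

lemma mUnif_of_adj (h : G.Adj x y) : mUnif G x y = 1 / (G.degree x : ℝ) := by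
  simp [mUnif, h]

lemma mUnif_eq_zero (x : V) : ∀ v ∉ G.neighborFinset x, mUnif G x v = 0 := by
  intro v hv
  rw [SimpleGraph.mem_neighborFinset] at hv
  simp [mUnif, hv]

lemma one_le_degree (h : G.Adj x y) : (1 : ℝ) ≤ G.degree x := by
  exact_mod_cast (G.degree_pos_iff_exists_adj x).2 ⟨y, h⟩

lemma sum_mUnif (h : G.Adj x y) : ∑ v ∈ G.neighborFinset x, mUnif G x v = 1 := by
  have hd := one_le_degree G h
  rw [Finset.sum_congr rfl fun v hv => mUnif_of_adj G ((G.mem_neighborFinset x v).1 hv)]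
  rw [Finset.sum_const, G.card_neighborFinset_eq_degree, nsmul_eq_mul]
  field_simp

lemma mUnif_le_one (x v : V) : mUnif G x v ≤ 1 := by
  by_cases h : G.Adj x v
  · rw [mUnif_of_adj G h]
    exact div_le_one_of_le₀ (one_le_degree G h) (by positivity)
  · simp [mUnif, h]

open scoped Classical in
lemma sum_mUnif_mul_ite (h : G.Adj x y) (s t : ℝ) :
    ∑ v ∈ G.neighborFinset x, mUnif G x v * (if v = y then s else t)
      = 1 / (G.degree x : ℝ) * s + (1 - 1 / (G.degree x : ℝ)) * t := by
  have hite (v : V) : mUnif G x v * (if v = y then s else t)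
      = mUnif G x v * t + if v = y then mUnif G x v * (s - t) else 0 := by
    split_ifs <;> ring
  simp_rw [hite]
  rw [Finset.sum_add_distrib, ← Finset.sum_mul, sum_mUnif G h, Finset.sum_ite_eq',
    if_pos ((G.mem_neighborFinset x y).2 h), mUnif_of_adj G h]
  ring

end Uniform

section Tree

variable {G : SimpleGraph V}

lemma not_adj_of_isAcyclic (hG : G.IsAcyclic) {x y z : V} (hxy : G.Adj x y)
    (hxz : G.Adj x z) : ¬ G.Adj z y := by
  intro hzy
  have h := (hG.subsingleton_path x y).elim (SimpleGraph.Path.singleton hxy)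
    ⟨.cons hxz (.cons hzy .nil), by simp [hxz.ne, hxy.ne, hzy.ne]⟩
  simpa [SimpleGraph.Path.singleton] using congrArg (fun p => p.1.length) h

lemma dist_eq_length_of_isPath (hG : G.IsAcyclic) {u v : V} (p : G.Walk u v)
    (hp : p.IsPath) : G.dist u v = p.length := by
  obtain ⟨q, hq, hlen⟩ := p.reachable.exists_path_of_dist
  rw [← hlen, congrArg (fun r => r.1.length) ((hG.subsingleton_path u v).elim ⟨p, hp⟩ ⟨q, hq⟩)]

open scoped Classical in
lemma gdist_of_adj_of_adj (hG : G.IsAcyclic) {x y u v : V} (hxy : G.Adj x y)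
    (hxu : G.Adj x u) (hyv : G.Adj y v) :
    gdist G u v = if u = y then 1 else if v = x then 1 else 3 := by
  unfold gdist
  split_ifs with huy hvx
  · subst huy
    simp [SimpleGraph.dist_eq_one_iff_adj.2 hyv]
  · subst hvx
    simp [SimpleGraph.dist_eq_one_iff_adj.2 hxu.symm]
  · have huv : u ≠ v := by
      rintro rfl
      exact not_adj_of_isAcyclic hG hxy hxu hyv.symm
    rw [dist_eq_length_of_isPath hG (.cons hxu.symm (.cons hxy (.cons hyv .nil)))]
    · simp
    · simp [hxu.ne', huy, huv, hxy.ne, Ne.symm hvx, hyv.ne]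

end Tree

/-- Densities, with respect to the product measure, of an optimal coupling between two
distributions each having an atom (of mass `α`, respectively `β`): `e` at the pair of atoms,
`b` and `a` where exactly one coordinate is an atom, and `k` elsewhere. -/
lemma exists_coupling_density {α β : ℝ} (hα : 0 ≤ α) (hβ : 0 ≤ β)
    (h : α = 1 ∨ β = 1 ∨ α < 1 ∧ β < 1 ∧ α + β ≤ 1) :
    ∃ e a b k : ℝ, 0 ≤ e ∧ 0 ≤ a ∧ 0 ≤ b ∧ 0 ≤ k ∧
      β * e + (1 - β) * b = 1 ∧ β * a + (1 - β) * k = 1 ∧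
      α * e + (1 - α) * a = 1 ∧ α * b + (1 - α) * k = 1 ∧
      (1 - α) * (1 - β) * k = max (1 - α - β) 0 := by
  rcases h with rfl | rfl | ⟨hα1, hβ1, hαβ⟩
  · refine ⟨1, 1, 1, 1, by simp, by simp, by simp, by simp, by ring, by ring, by ring,
      by ring, ?_⟩
    rw [max_eq_right (by linarith)]
    ring
  · refine ⟨1, 1, 1, 1, by simp, by simp, by simp, by simp, by ring, by ring, by ring,
      by ring, ?_⟩
    rw [max_eq_right (by linarith)]
    ring
  · have ha : 0 < 1 - α := by linarith
    have hb : 0 < 1 - β := by linarith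
    have hk : 0 ≤ 1 - α - β := by linarith
    refine ⟨0, 1 / (1 - α), 1 / (1 - β), (1 - α - β) / ((1 - α) * (1 - β)), le_rfl,
      by positivity, by positivity, by positivity, ?_, ?_, ?_, ?_, ?_⟩
    · field_simp
      ring
    · field_simp
      ring
    · field_simp
      ring
    · field_simp
      ring
    · rw [max_eq_left hk]
      field_simp

section TransportCost

variable {G : SimpleGraph V} [∀ v, Fintype (G.neighborSet v)] {x y : V}

open scoped Classical in
lemma transportCost_eq_sum (hG : G.IsAcyclic) (hxy : G.Adj x y) {A : V → V → ℝ}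
    (hA : IsCoupling (mUnif G x) (mUnif G y) A) :
    ∑ᶠ (u : V) (v : V), A u v * gdist G u v
      = ∑ u ∈ G.neighborFinset x, ∑ v ∈ G.neighborFinset y,
          A u v * (if u = y then 1 else if v = x then 1 else 3) := by
  rw [finsum_finsum_eq_sum_sum fun u v huv => hA.mem_of_ne_zero (mUnif_eq_zero G x)
    (mUnif_eq_zero G y) (left_ne_zero_of_mul huv)]
  refine Finset.sum_congr rfl fun u hu => Finset.sum_congr rfl fun v hv => ?_
  rw [gdist_of_adj_of_adj hG hxy ((G.mem_neighborFinset x u).1 hu)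
    ((G.mem_neighborFinset y v).1 hv)]

lemma le_transportCost (hG : G.IsAcyclic) (hxy : G.Adj x y) {A : V → V → ℝ}
    (hA : IsCoupling (mUnif G x) (mUnif G y) A) :
    1 + 2 * max (1 - 1 / (G.degree x : ℝ) - 1 / (G.degree y : ℝ)) 0
      ≤ ∑ᶠ (u : V) (v : V), A u v * gdist G u v := by
  classical
  have hmem {u v : V} (huv : A u v ≠ 0) :=
    hA.mem_of_ne_zero (mUnif_eq_zero G x) (mUnif_eq_zero G y) huv
  have hrow (u : V) : ∑ v ∈ G.neighborFinset y, A u v = mUnif G x u := by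
    rw [← hA.2.2.1 u, finsum_eq_sum_of_forall_mem fun v hv => (hmem hv).2]
  have hcol (v : V) : ∑ u ∈ G.neighborFinset x, A u v = mUnif G y v := by
    rw [← hA.2.2.2 v, finsum_eq_sum_of_forall_mem fun u hu => (hmem hu).1]
  have htotal : ∑ u ∈ G.neighborFinset x, ∑ v ∈ G.neighborFinset y, A u v = 1 := by
    simp_rw [hrow, sum_mUnif G hxy]
  rw [transportCost_eq_sum hG hxy hA]
  rcases max_choice (1 - 1 / (G.degree x : ℝ) - 1 / (G.degree y : ℝ)) 0 with h | h
  · have hy : ∑ u ∈ G.neighborFinset x, ∑ v ∈ G.neighborFinset y,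
        A u v * (if u = y then 2 else 0) = 2 / (G.degree x : ℝ) := by
      simp_rw [← Finset.sum_mul, hrow, sum_mUnif_mul_ite G hxy]
      ring
    have hx : ∑ u ∈ G.neighborFinset x, ∑ v ∈ G.neighborFinset y,
        A u v * (if v = x then 2 else 0) = 2 / (G.degree y : ℝ) := by
      rw [Finset.sum_comm]
      simp_rw [← Finset.sum_mul, hcol, sum_mUnif_mul_ite G hxy.symm]
      ring
    calc 1 + 2 * max (1 - 1 / (G.degree x : ℝ) - 1 / (G.degree y : ℝ)) 0
        = 1 * 3 - 2 / (G.degree x : ℝ) - 2 / (G.degree y : ℝ) := by rw [h]; ring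
      _ = ∑ u ∈ G.neighborFinset x, ∑ v ∈ G.neighborFinset y,
            (A u v * 3 - A u v * (if u = y then 2 else 0)
              - A u v * (if v = x then 2 else 0)) := by
          simp_rw [Finset.sum_sub_distrib, hy, hx, ← Finset.sum_mul, htotal]
      _ ≤ _ := by
          refine Finset.sum_le_sum fun u _ => Finset.sum_le_sum fun v _ => ?_
          have h0 := (hA.1 u v).1
          split_ifs <;> linarith
  · rw [h, mul_zero, add_zero]
    refine htotal.symm.le.trans ?_
    refine Finset.sum_le_sum fun u _ => Finset.sum_le_sum fun v _ => ?_
    have h0 := (hA.1 u v).1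
    split_ifs <;> linarith

lemma exists_optimal_coupling (hG : G.IsAcyclic) (hxy : G.Adj x y) :
    ∃ A : V → V → ℝ, IsCoupling (mUnif G x) (mUnif G y) A ∧
      1 + 2 * max (1 - 1 / (G.degree x : ℝ) - 1 / (G.degree y : ℝ)) 0
        = ∑ᶠ (u : V) (v : V), A u v * gdist G u v := by
  classical
  have hcases {n : ℕ} (hn : (1 : ℝ) ≤ n) : 1 / (n : ℝ) = 1 ∨ 1 / (n : ℝ) ≤ 1 / 2 := by
    have hn' : 1 ≤ n := by exact_mod_cast hn
    rcases hn'.eq_or_lt with rfl | h2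
    · simp
    · exact Or.inr (one_div_le_one_div_of_le two_pos (by exact_mod_cast h2))
  obtain ⟨e, a, b, k, he, ha, hb, hk, hrow_atom, hrow, hcol_atom, hcol, hcost⟩ :=
    exists_coupling_density (α := 1 / (G.degree x : ℝ)) (β := 1 / (G.degree y : ℝ))
      (by positivity) (by positivity) (by
        rcases hcases (one_le_degree G hxy) with h | h
        · exact Or.inl h
        rcases hcases (one_le_degree G hxy.symm) with h' | h'
        · exact Or.inr (Or.inl h')
        exact Or.inr (Or.inr ⟨by linarith, by linarith, by linarith⟩))
  let A : V → V → ℝ := fun u v => mUnif G x u * (mUnif G y v *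
    if v = x then (if u = y then e else a) else (if u = y then b else k))
  have hA : IsCoupling (mUnif G x) (mUnif G y) A := by
    refine isCoupling_of_sum_eq (p := G.neighborFinset x) (q := G.neighborFinset y)
      (fun u v => ?_) (fun u v huv => ?_) (mUnif_le_one G x) (fun u => ?_) (fun v => ?_)
    · refine mul_nonneg (mUnif_nonneg G x u) (mul_nonneg (mUnif_nonneg G y v) ?_)
      split_ifs <;> assumption
    · constructor <;> by_contra hmem
      · exact huv (by simp [A, mUnif_eq_zero G x u hmem])
      · exact huv (by simp [A, mUnif_eq_zero G y v hmem])
    · rw [← Finset.mul_sum, sum_mUnif_mul_ite G hxy.symm]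
      split_ifs <;> simp only [hrow_atom, hrow, mul_one]
    · have hcomm (u : V) : A u v = mUnif G y v * (mUnif G x u *
          if u = y then (if v = x then e else b) else (if v = x then a else k)) := by
        simp only [A]
        split_ifs <;> ring
      simp_rw [hcomm]
      rw [← Finset.mul_sum, sum_mUnif_mul_ite G hxy]
      split_ifs <;> simp only [hcol_atom, hcol, mul_one]
  refine ⟨A, hA, ?_⟩
  have hsum (u : V) : ∑ v ∈ G.neighborFinset y,
      A u v * (if u = y then 1 else if v = x then 1 else 3)
        = mUnif G x u * if u = y then 1 else 1 + 2 * ((1 - 1 / (G.degree y : ℝ)) * k) := by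
    have hcost_density (v : V) : A u v * (if u = y then 1 else if v = x then 1 else 3)
        = mUnif G x u * (mUnif G y v *
          if v = x then (if u = y then e else a) else (if u = y then b else 3 * k)) := by
      simp only [A]
      split_ifs <;> ring
    simp_rw [hcost_density]
    rw [← Finset.mul_sum, sum_mUnif_mul_ite G hxy.symm]
    split_ifs
    · rw [hrow_atom]
    · linear_combination mUnif G x u * hrow
  rw [transportCost_eq_sum hG hxy hA, Finset.sum_congr rfl fun u _ => hsum u,
    sum_mUnif_mul_ite G hxy, ← hcost]
  ring

end TransportCost

end ORC

/-- Trees attain equality in the Jost–Liu lower bound: for adjacent vertices `x, y` of a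
locally finite tree, `W1(m_x, m_y) = 1 + 2(1 - 1/d_x - 1/d_y)₊`, so
`Ric(x,y) = -2(1 - 1/d_x - 1/d_y)₊`. -/
theorem tree_attains_jost_liu_bound {V : Type*} (G : SimpleGraph V)
    [∀ v, Fintype (G.neighborSet v)] (hconn : G.Connected) (hacyclic : G.IsAcyclic)
    (x y : V) (hadj : G.Adj x y) :
    W1 (gdist G) (mUnif G x) (mUnif G y)
      = 1 + 2 * max (1 - 1 / (G.degree x : ℝ) - 1 / (G.degree y : ℝ)) 0 ∧
    ricEdge G x y = -2 * max (1 - 1 / (G.degree x : ℝ) - 1 / (G.degree y : ℝ)) 0 := by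
  have hW : W1 (gdist G) (mUnif G x) (mUnif G y)
      = 1 + 2 * max (1 - 1 / (G.degree x : ℝ) - 1 / (G.degree y : ℝ)) 0 := by
    refine IsLeast.csInf_eq ⟨exists_optimal_coupling hacyclic hadj, ?_⟩
    rintro c ⟨A, hA, rfl⟩
    exact le_transportCost hacyclic hadj hA
  refine ⟨hW, ?_⟩
  rw [ricEdge, hW]
  ring
end
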